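/- For every ℓ ≤ 0 there exists C > 0, depending only on ℓ and χ₁, such that for all m ≠ 0, all t ≠ 0 and all f ∈ 𝒮(ℝ): sup_{x ∈ ℝ} |(2π)^{−1} ∫_ℝ e^{ixξ} (ξ⁴ + m²)^{ℓ/2} e^{−it√(ξ⁴+m²)} χ₁(ξ⁴) f̂(ξ) dξ| ≤ C |m|^ℓ ⟨m⟩^{1/2} |t|^{−1/4} ‖f‖_{L¹(ℝ)}. In other words, ‖(Δ² + m²)^{ℓ/2} e^{−it√(Δ²+m²)} χ₁(Δ²)‖_{L¹→L^∞} ≲ |m|^ℓ ⟨m⟩^{1/2} |t|^{−1/4}. -/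

import Mathlib

open MeasureTheory

/-- A van der Corput type estimate for a convex phase with second derivative `v ≥ x² / δ⁴`. -/
theorem norm_integral_exp_le_of_sq_le_deriv {g u v : ℝ → ℝ} {a b δ : ℝ} (hab : a ≤ b)
    (hδ : 0 < δ) (hg : ∀ x, HasDerivAt g (u x) x) (hu : ∀ x, HasDerivAt u (v x) x)
    (hv : Continuous v) (hlow : ∀ x ∈ Set.Icc a b, x ^ 2 ≤ δ ^ 4 * v x) :
    ‖∫ x in a..b, Complex.exp (Complex.I * (g x : ℂ))‖ ≤ (1 + 3 * Real.pi) * δ := by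
  have hgc : Continuous g := continuous_iff_continuousAt.2 fun x => (hg x).continuousAt
  have huc : Continuous u := continuous_iff_continuousAt.2 fun x => (hu x).continuousAt
  have hw : ∀ x, 0 < 1 + δ ^ 2 * u x ^ 2 := fun x => by positivity
  set q : ℝ → ℝ := fun x => δ ^ 2 * u x / (1 + δ ^ 2 * u x ^ 2) with hq
  set q' : ℝ → ℝ := fun x =>
    δ ^ 2 * v x * (1 - δ ^ 2 * u x ^ 2) / (1 + δ ^ 2 * u x ^ 2) ^ 2 with hq'
  set e : ℝ → ℂ := fun x => Complex.exp (Complex.I * (g x : ℂ)) with he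
  set F : ℝ → ℂ := fun x => -Complex.I * (q x : ℂ) * e x with hF
  have hec : Continuous e := by fun_prop
  have hen : ∀ x, ‖e x‖ = 1 := fun x => by
    simp only [he]; rw [mul_comm]; exact Complex.norm_exp_ofReal_mul_I _
  have hqd : ∀ x, HasDerivAt q (q' x) x := fun x => by
    have h := ((hu x).const_mul (δ ^ 2)).div
      ((((hu x).pow 2).const_mul (δ ^ 2)).const_add 1) (hw x).ne'
    refine h.congr_deriv ?_
    simp only [hq']
    congr 1
    simp
    ring
  have hed : ∀ x, HasDerivAt e (e x * (Complex.I * (u x : ℂ))) x := fun x =>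
    ((hg x).ofReal_comp.const_mul Complex.I).cexp
  have hFd : ∀ x, HasDerivAt F
      (-Complex.I * (q' x : ℂ) * e x + (q x * u x : ℝ) * e x) x := fun x => by
    refine (((hqd x).ofReal_comp.const_mul (-Complex.I)).mul (hed x)).congr_deriv ?_
    push_cast
    linear_combination (-(q x : ℂ) * e x * u x) * Complex.I_sq
  have hqc : Continuous q := by
    simp only [hq]; exact (by fun_prop : Continuous _).div (by fun_prop) fun x => (hw x).ne'
  have hqc' : Continuous q' := by
    simp only [hq']
    exact (by fun_prop : Continuous _).div (by fun_prop) fun x => (pow_pos (hw x) 2).ne'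
  have hFc : Continuous fun x => -Complex.I * (q' x : ℂ) * e x + (q x * u x : ℝ) * e x := by
    fun_prop
  have hFi := intervalIntegral.integral_eq_sub_of_hasDerivAt (fun x _ => hFd x)
    (hFc.intervalIntegrable a b)
  set G : ℝ → ℝ := fun x => 2 * δ * Real.arctan (δ * u x) + δ * Real.arctan (x / δ) with hG
  set G' : ℝ → ℝ := fun x =>
    2 * δ ^ 2 * v x / (1 + δ ^ 2 * u x ^ 2) + 1 / (1 + (x / δ) ^ 2) with hG'
  have hGd : ∀ x, HasDerivAt G (G' x) x := fun x => by
    have h := (((hu x).const_mul δ).arctan.const_mul (2 * δ)).add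
      (((hasDerivAt_id x).div_const δ).arctan.const_mul δ)
    refine h.congr_deriv ?_
    simp only [hG', id]
    have := hw x
    have h2 : 0 < 1 + (x / δ) ^ 2 := by positivity
    rw [mul_pow]
    congr 1
    · field_simp
    · field_simp
  have hGc' : Continuous G' := by
    simp only [hG']
    refine Continuous.add ?_ ?_
    · exact (by fun_prop : Continuous _).div (by fun_prop) fun x => (hw x).ne'
    · exact continuous_const.div (by fun_prop) fun x => by positivity
  have hGi := intervalIntegral.integral_eq_sub_of_hasDerivAt (fun x _ => hGd x)
    (hGc'.intervalIntegrable a b)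
  have hpt : ∀ x ∈ Set.Icc a b,
      ‖e x - (-Complex.I * (q' x : ℂ) * e x + (q x * u x : ℝ) * e x)‖ ≤ G' x := fun x hx => by
    have hwx := hw x
    have h1 : e x - (-Complex.I * (q' x : ℂ) * e x + (q x * u x : ℝ) * e x)
        = ((1 - q x * u x : ℝ) + Complex.I * (q' x : ℂ)) * e x := by
      push_cast; ring
    have hv0 : 0 ≤ v x := by
      have := hlow x hx
      by_contra! hneg
      nlinarith [sq_nonneg x, mul_neg_of_pos_of_neg (pow_pos hδ 4) hneg]
    have h2 : 1 - q x * u x = 1 / (1 + δ ^ 2 * u x ^ 2) := by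
      simp only [hq]; field_simp; ring
    have h3 : |q' x| ≤ δ ^ 2 * v x / (1 + δ ^ 2 * u x ^ 2) := by
      simp only [hq']
      rw [abs_div, abs_mul, abs_of_nonneg (by positivity : 0 ≤ δ ^ 2 * v x),
        abs_of_pos (pow_pos hwx 2), div_le_div_iff₀ (by positivity) hwx]
      have : |1 - δ ^ 2 * u x ^ 2| ≤ 1 + δ ^ 2 * u x ^ 2 := by
        rw [abs_le]; constructor <;> nlinarith [mul_nonneg (sq_nonneg δ) (sq_nonneg (u x))]
      have h4 : 0 ≤ δ ^ 2 * v x * (1 + δ ^ 2 * u x ^ 2) := by positivity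
      nlinarith [mul_le_mul_of_nonneg_left this h4]
    have h5 : 1 ≤ δ ^ 2 * v x + 1 / (1 + (x / δ) ^ 2) := by
      have h6 : (x / δ) ^ 2 ≤ δ ^ 2 * v x := by
        rw [div_pow, div_le_iff₀ (by positivity)]
        nlinarith [hlow x hx]
      have h7 : 1 ≤ (x / δ) ^ 2 + 1 / (1 + (x / δ) ^ 2) := by
        have : 0 < 1 + (x / δ) ^ 2 := by positivity
        rw [← sub_nonneg]
        have h8 : (x / δ) ^ 2 + 1 / (1 + (x / δ) ^ 2) - 1
            = ((x / δ) ^ 2) ^ 2 / (1 + (x / δ) ^ 2) := by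
          generalize (x / δ) ^ 2 = z at *
          field_simp; ring
        rw [h8]; positivity
      linarith
    have h9 : 1 / (1 + δ ^ 2 * u x ^ 2)
        ≤ δ ^ 2 * v x / (1 + δ ^ 2 * u x ^ 2) + 1 / (1 + (x / δ) ^ 2) := by
      have h10 : 0 ≤ 1 / (1 + (x / δ) ^ 2) := by positivity
      rw [div_add' _ _ _ hwx.ne']
      refine div_le_div_of_nonneg_right ?_ hwx.le
      nlinarith [mul_nonneg h10 (by positivity : 0 ≤ δ ^ 2 * u x ^ 2)]
    calc _ = ‖((1 - q x * u x : ℝ) : ℂ) + Complex.I * (q' x : ℂ)‖ := by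
          rw [h1, norm_mul, hen, mul_one]
      _ ≤ |1 - q x * u x| + |q' x| := by
          refine (norm_add_le _ _).trans ?_
          rw [norm_mul, Complex.norm_I, one_mul, Complex.norm_real, Complex.norm_real,
            Real.norm_eq_abs, Real.norm_eq_abs]
      _ ≤ G' x := by
          rw [h2, abs_of_pos (by positivity)]
          have : G' x = δ ^ 2 * v x / (1 + δ ^ 2 * u x ^ 2) + 1 / (1 + (x / δ) ^ 2)
              + δ ^ 2 * v x / (1 + δ ^ 2 * u x ^ 2) := by simp only [hG']; ring
          linarith
  have hrem : ‖∫ x in a..b, (e x - (-Complex.I * (q' x : ℂ) * e x + (q x * u x : ℝ) * e x))‖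
      ≤ G b - G a := by
    rw [← hGi]
    exact intervalIntegral.norm_integral_le_of_norm_le hab
      (Filter.Eventually.of_forall fun x hx => hpt x (Set.Ioc_subset_Icc_self hx))
      (hGc'.intervalIntegrable a b)
  rw [intervalIntegral.integral_sub (hec.intervalIntegrable a b) (hFc.intervalIntegrable a b),
    hFi] at hrem
  have hFn : ∀ x, ‖F x‖ ≤ δ / 2 := fun x => by
    simp only [hF]
    rw [norm_mul, hen, mul_one, norm_mul, norm_neg, Complex.norm_I, one_mul, Complex.norm_real,
      Real.norm_eq_abs]
    simp only [hq]
    rw [abs_div, abs_of_pos (hw x), abs_mul, abs_of_pos (pow_pos hδ 2),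
      div_le_div_iff₀ (hw x) two_pos, ← sq_abs (u x)]
    nlinarith [mul_nonneg hδ.le (sq_nonneg (δ * |u x| - 1))]
  have hGb : G b - G a ≤ 3 * Real.pi * δ := by
    simp only [hG]
    have h1 := Real.arctan_lt_pi_div_two (δ * u b)
    have h2 := Real.neg_pi_div_two_lt_arctan (δ * u a)
    have h3 := Real.arctan_lt_pi_div_two (b / δ)
    have h4 := Real.neg_pi_div_two_lt_arctan (a / δ)
    nlinarith
  have h1 := norm_le_norm_sub_add (∫ x in a..b, e x) (F b - F a)
  have h2 := norm_sub_le (F b) (F a)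
  linarith [hFn a, hFn b]

/-- Integration by parts against an amplitude vanishing at the right endpoint. -/
theorem norm_integral_mul_le_of_norm_primitive_le {h : ℝ → ℂ} {p p' : ℝ → ℝ} {a b D : ℝ}
    (hab : a ≤ b) (hh : Continuous h) (hp : ∀ x, HasDerivAt p (p' x) x) (hp' : Continuous p')
    (hpb : p b = 0) (hD : ∀ x ∈ Set.Icc a b, ‖∫ y in a..x, h y‖ ≤ D) :
    ‖∫ x in a..b, (p x : ℂ) * h x‖ ≤ D * ∫ x in a..b, |p' x| := by
  have hJ : ∀ x, HasDerivAt (fun x => ∫ y in a..x, h y) (h x) x := fun x =>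
    intervalIntegral.integral_hasDerivAt_right (hh.intervalIntegrable _ _)
      (hh.stronglyMeasurableAtFilter _ _) hh.continuousAt
  have hJc : Continuous fun x => ∫ y in a..x, h y :=
    continuous_iff_continuousAt.2 fun x => (hJ x).continuousAt
  have hpc' : Continuous fun x => (p' x : ℂ) := by fun_prop
  rw [intervalIntegral.integral_mul_deriv_eq_deriv_mul (fun x _ => (hp x).ofReal_comp)
    (fun x _ => hJ x) (hpc'.intervalIntegrable a b) (hh.intervalIntegrable a b), hpb]
  simp only [intervalIntegral.integral_same, Complex.ofReal_zero, zero_mul, mul_zero, sub_zero,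
    zero_sub, norm_neg]
  rw [← intervalIntegral.integral_const_mul]
  refine intervalIntegral.norm_integral_le_of_norm_le hab
    (Filter.Eventually.of_forall fun x hx => ?_)
    ((by fun_prop : Continuous fun x => D * |p' x|).intervalIntegrable a b)
  rw [norm_mul, Complex.norm_real, Real.norm_eq_abs, mul_comm]
  exact mul_le_mul_of_nonneg_right (hD x (Set.Ioc_subset_Icc_self hx)) (abs_nonneg _)

theorem hasDerivAt_sqrt_quartic {m : ℝ} (hm : m ≠ 0) (x : ℝ) :
    HasDerivAt (fun x => √(x ^ 4 + m ^ 2)) (2 * x ^ 3 / √(x ^ 4 + m ^ 2)) x := by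
  have h0 : 0 < x ^ 4 + m ^ 2 := by positivity
  refine (((hasDerivAt_pow 4 x).add_const (m ^ 2)).sqrt h0.ne').congr_deriv ?_
  have := Real.sqrt_pos.2 h0
  field_simp
  push_cast
  ring

theorem hasDerivAt_deriv_sqrt_quartic {m : ℝ} (hm : m ≠ 0) (x : ℝ) :
    HasDerivAt (fun x => 2 * x ^ 3 / √(x ^ 4 + m ^ 2))
      (2 * x ^ 2 * (x ^ 4 + 3 * m ^ 2) / √(x ^ 4 + m ^ 2) ^ 3) x := by
  have h0 : 0 < x ^ 4 + m ^ 2 := by positivity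
  have hs := Real.sqrt_pos.2 h0
  refine (((hasDerivAt_pow 3 x).const_mul 2).div (hasDerivAt_sqrt_quartic hm x)
    hs.ne').congr_deriv ?_
  have h2 := Real.sq_sqrt h0.le
  generalize √(x ^ 4 + m ^ 2) = s at *
  field_simp
  push_cast
  rw [h2]
  ring

theorem norm_integral_exp_sqrt_quartic_le {R m : ℝ} (hm : m ≠ 0) {t : ℝ} (ht : 0 < t)
    (z : ℝ) {b : ℝ} (hb : b ∈ Set.Icc (-R) R) :
    ‖∫ x in (-R)..b, Complex.exp (Complex.I * ((t * √(x ^ 4 + m ^ 2) + z * x : ℝ) : ℂ))‖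
      ≤ (1 + 3 * Real.pi) * ((1 + R ^ 2) ^ ((1 : ℝ) / 4) * (1 + |m|) ^ ((1 : ℝ) / 4)
        * t ^ (-(1 / 4) : ℝ)) := by
  have hδ : 0 < (1 + R ^ 2) ^ ((1 : ℝ) / 4) * (1 + |m|) ^ ((1 : ℝ) / 4)
      * t ^ (-(1 / 4) : ℝ) := by positivity
  have hδ4 : ((1 + R ^ 2) ^ ((1 : ℝ) / 4) * (1 + |m|) ^ ((1 : ℝ) / 4)
      * t ^ (-(1 / 4) : ℝ)) ^ 4 = (1 + R ^ 2) * (1 + |m|) / t := by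
    rw [mul_pow, mul_pow, ← Real.rpow_mul_natCast (by positivity),
      ← Real.rpow_mul_natCast (by positivity), ← Real.rpow_mul_natCast ht.le]
    norm_num [Real.rpow_neg_one]
    rfl
  refine norm_integral_exp_le_of_sq_le_deriv hb.1 hδ
    (fun x => ((hasDerivAt_sqrt_quartic hm x).const_mul t).add ((hasDerivAt_id x).const_mul z))
    (fun x => ((hasDerivAt_deriv_sqrt_quartic hm x).const_mul t).add_const (z * 1)) ?_ ?_
  · refine continuous_const.mul ((by fun_prop : Continuous _).div (by fun_prop) fun x => ?_)
    have : 0 < x ^ 4 + m ^ 2 := by positivity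
    positivity
  · intro x hx
    rw [hδ4]
    have h0 : 0 < x ^ 4 + m ^ 2 := by positivity
    have hs := Real.sqrt_pos.2 h0
    have h2 := Real.sq_sqrt h0.le
    have hxR : x ^ 2 ≤ R ^ 2 := by
      have := hx.1
      have := hx.2.trans hb.2
      nlinarith
    have hle : √(x ^ 4 + m ^ 2) ≤ (1 + R ^ 2) * (1 + |m|) := by
      have h3 : √(x ^ 4 + m ^ 2) ≤ x ^ 2 + |m| := by
        refine Real.sqrt_le_iff.2 ⟨by positivity, ?_⟩
        have := sq_abs m
        nlinarith [mul_nonneg (sq_nonneg x) (abs_nonneg m)]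
      nlinarith [mul_nonneg (sq_nonneg R) (abs_nonneg m)]
    have h4 : (1 + R ^ 2) * (1 + |m|) / t
        * (t * (2 * x ^ 2 * (x ^ 4 + 3 * m ^ 2) / √(x ^ 4 + m ^ 2) ^ 3))
        = (1 + R ^ 2) * (1 + |m|) * (2 * x ^ 2 * (x ^ 4 + 3 * m ^ 2))
          / √(x ^ 4 + m ^ 2) ^ 3 := by
      field_simp
    rw [h4, le_div_iff₀ (by positivity), pow_succ √(x ^ 4 + m ^ 2) 2, h2]
    calc x ^ 2 * ((x ^ 4 + m ^ 2) * √(x ^ 4 + m ^ 2))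
        ≤ x ^ 2 * ((x ^ 4 + m ^ 2) * ((1 + R ^ 2) * (1 + |m|))) := by gcongr
      _ = (1 + R ^ 2) * (1 + |m|) * (x ^ 2 * (x ^ 4 + m ^ 2)) := by ring
      _ ≤ (1 + R ^ 2) * (1 + |m|) * (2 * x ^ 2 * (x ^ 4 + 3 * m ^ 2)) := by
        refine mul_le_mul_of_nonneg_left ?_ (by positivity)
        nlinarith [sq_nonneg (x * m), sq_nonneg (x ^ 3)]

theorem hasDerivAt_quartic_rpow {m : ℝ} (hm : m ≠ 0) (s x : ℝ) :
    HasDerivAt (fun x => (x ^ 4 + m ^ 2) ^ s)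
      (4 * x ^ 3 * s * (x ^ 4 + m ^ 2) ^ (s - 1)) x := by
  have h0 : 0 < x ^ 4 + m ^ 2 := by positivity
  exact (((hasDerivAt_pow 4 x).add_const (m ^ 2)).rpow_const (Or.inl h0.ne')).congr_deriv
    (by norm_num)

theorem continuous_quartic_rpow {m : ℝ} (hm : m ≠ 0) (s : ℝ) :
    Continuous fun x : ℝ => (x ^ 4 + m ^ 2) ^ s :=
  (by fun_prop : Continuous fun x : ℝ => x ^ 4 + m ^ 2).rpow_const fun x =>
    Or.inl (by positivity)

theorem quartic_rpow_le {m : ℝ} (hm : m ≠ 0) {ℓ : ℝ} (hℓ : ℓ ≤ 0) (x : ℝ) :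
    (x ^ 4 + m ^ 2) ^ (ℓ / 2) ≤ |m| ^ ℓ := by
  have h1 : |m| ^ ℓ = (m ^ 2) ^ (ℓ / 2) := by
    rw [← sq_abs, ← Real.rpow_natCast_mul (abs_nonneg m)]
    congr 1
    push_cast
    ring
  rw [h1]
  exact Real.rpow_le_rpow_of_nonpos (by positivity) (by nlinarith [sq_nonneg (x ^ 2)])
    (by linarith)

theorem integral_abs_deriv_quartic_rpow_le {R : ℝ} (hR : 0 ≤ R) {m : ℝ} (hm : m ≠ 0) {ℓ : ℝ}
    (hℓ : ℓ ≤ 0) :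
    ∫ x in (-R)..R, |4 * x ^ 3 * (ℓ / 2) * (x ^ 4 + m ^ 2) ^ (ℓ / 2 - 1)| ≤ 2 * |m| ^ ℓ := by
  have hc : Continuous fun x : ℝ => 4 * x ^ 3 * (ℓ / 2) * (x ^ 4 + m ^ 2) ^ (ℓ / 2 - 1) :=
    (by fun_prop : Continuous fun x : ℝ => 4 * x ^ 3 * (ℓ / 2)).mul (continuous_quartic_rpow hm _)
  have hpos : ∀ x s : ℝ, 0 ≤ (x ^ 4 + m ^ 2) ^ s := fun x s => by positivity
  have hi := fun a b => intervalIntegral.integral_eq_sub_of_hasDerivAt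
    (fun x (_ : x ∈ Set.uIcc a b) => hasDerivAt_quartic_rpow hm (ℓ / 2) x)
    (hc.intervalIntegrable a b)
  rw [← intervalIntegral.integral_add_adjacent_intervals
    (hc.abs.intervalIntegrable (-R) 0) (hc.abs.intervalIntegrable 0 R)]
  have h1 : ∫ x in (-R)..0, |4 * x ^ 3 * (ℓ / 2) * (x ^ 4 + m ^ 2) ^ (ℓ / 2 - 1)|
      = ∫ x in (-R)..0, 4 * x ^ 3 * (ℓ / 2) * (x ^ 4 + m ^ 2) ^ (ℓ / 2 - 1) := by
    refine intervalIntegral.integral_congr fun x hx => ?_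
    rw [Set.uIcc_of_le (by linarith)] at hx
    refine abs_of_nonneg (mul_nonneg (mul_nonneg_of_nonpos_of_nonpos ?_ (by linarith)) (hpos _ _))
    nlinarith [mul_nonneg (sq_nonneg x) (neg_nonneg.2 hx.2)]
  have h2 : ∫ x in (0 : ℝ)..R, |4 * x ^ 3 * (ℓ / 2) * (x ^ 4 + m ^ 2) ^ (ℓ / 2 - 1)|
      = ∫ x in (0 : ℝ)..R, -(4 * x ^ 3 * (ℓ / 2) * (x ^ 4 + m ^ 2) ^ (ℓ / 2 - 1)) := by
    refine intervalIntegral.integral_congr fun x hx => ?_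
    rw [Set.uIcc_of_le hR] at hx
    refine abs_of_nonpos (mul_nonpos_of_nonpos_of_nonneg
      (mul_nonpos_of_nonneg_of_nonpos ?_ (by linarith)) (hpos _ _))
    have := hx.1
    positivity
  rw [h1, h2, intervalIntegral.integral_neg, hi, hi]
  linarith [quartic_rpow_le hm hℓ 0, hpos (-R) (ℓ / 2), hpos R (ℓ / 2)]

/-- The kernel bound for amplitudes `(ξ⁴ + m²) ^ (ℓ / 2) * c ξ` with a cutoff `c`. -/
theorem exists_norm_kernel_le {c c' : ℝ → ℝ} (hc : ∀ x, HasDerivAt c (c' x) x)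
    (hc' : Continuous c') {R : ℝ} (hR : 0 ≤ R) (hcR : c R = 0) {ℓ : ℝ} (hℓ : ℓ ≤ 0) :
    ∃ C > 0, ∀ m : ℝ, m ≠ 0 → ∀ t : ℝ, 0 < t → ∀ z : ℝ,
      ‖∫ x in (-R)..R, (((x ^ 4 + m ^ 2) ^ (ℓ / 2) * c x : ℝ) : ℂ)
          * Complex.exp (Complex.I * ((t * √(x ^ 4 + m ^ 2) + z * x : ℝ) : ℂ))‖
        ≤ C * |m| ^ ℓ * (1 + |m|) ^ ((1 : ℝ) / 2) * t ^ (-(1 / 4) : ℝ) := by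
  have hcc : Continuous c := continuous_iff_continuousAt.2 fun x => (hc x).continuousAt
  obtain ⟨M, hM⟩ := isCompact_Icc.exists_bound_of_continuousOn (s := Set.Icc (-R) R)
    hcc.continuousOn
  obtain ⟨M', hM'⟩ := isCompact_Icc.exists_bound_of_continuousOn (s := Set.Icc (-R) R)
    hc'.continuousOn
  have h0 : (0 : ℝ) ∈ Set.Icc (-R) R := ⟨by linarith, hR⟩
  have hM0 : 0 ≤ M := (norm_nonneg _).trans (hM 0 h0)
  have hM0' : 0 ≤ M' := (norm_nonneg _).trans (hM' 0 h0)
  have hpi := Real.pi_pos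
  refine ⟨(1 + 3 * Real.pi) * (1 + R ^ 2) ^ ((1 : ℝ) / 4) * (2 * M + 2 * R * M' + 1),
    by positivity, fun m hm t ht z => ?_⟩
  have hA := hasDerivAt_quartic_rpow hm (ℓ / 2)
  have hAc := continuous_quartic_rpow hm (ℓ / 2)
  have hAc' : Continuous fun x : ℝ => 4 * x ^ 3 * (ℓ / 2) * (x ^ 4 + m ^ 2) ^ (ℓ / 2 - 1) :=
    (by fun_prop : Continuous fun x : ℝ => 4 * x ^ 3 * (ℓ / 2)).mul (continuous_quartic_rpow hm _)
  have hle : -R ≤ R := by linarith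
  refine (norm_integral_mul_le_of_norm_primitive_le hle (by fun_prop)
    (fun x => (hA x).mul (hc x)) ((hAc'.mul hcc).add (hAc.mul hc')) (by simp [hcR])
    (fun x hx => norm_integral_exp_sqrt_quartic_le hm ht z hx)).trans ?_
  have hvar : ∫ x in (-R)..R, |4 * x ^ 3 * (ℓ / 2) * (x ^ 4 + m ^ 2) ^ (ℓ / 2 - 1) * c x
      + (x ^ 4 + m ^ 2) ^ (ℓ / 2) * c' x| ≤ (2 * M + 2 * R * M' + 1) * |m| ^ ℓ := by
    have hb : ∫ x in (-R)..R, |4 * x ^ 3 * (ℓ / 2) * (x ^ 4 + m ^ 2) ^ (ℓ / 2 - 1) * c x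
        + (x ^ 4 + m ^ 2) ^ (ℓ / 2) * c' x|
        ≤ ∫ x in (-R)..R, (|4 * x ^ 3 * (ℓ / 2) * (x ^ 4 + m ^ 2) ^ (ℓ / 2 - 1)| * M
          + |m| ^ ℓ * M') := by
      refine intervalIntegral.integral_mono_on hle
        (((hAc'.mul hcc).add (hAc.mul hc')).abs.intervalIntegrable _ _)
        (((hAc'.abs.mul continuous_const).add continuous_const).intervalIntegrable _ _)
        fun x hx => ?_
      refine (abs_add_le _ _).trans ?_
      rw [abs_mul _ (c x), abs_mul _ (c' x)]
      refine add_le_add (mul_le_mul_of_nonneg_left (hM x hx) (abs_nonneg _))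
        (mul_le_mul ?_ (hM' x hx) (abs_nonneg _) (by positivity))
      rw [abs_of_nonneg (by positivity)]
      exact quartic_rpow_le hm hℓ x
    refine hb.trans ?_
    rw [intervalIntegral.integral_add ((hAc'.abs.mul_const M).intervalIntegrable _ _)
      (continuous_const.intervalIntegrable _ _), intervalIntegral.integral_mul_const,
      intervalIntegral.integral_const, smul_eq_mul]
    have := mul_le_mul_of_nonneg_right (integral_abs_deriv_quartic_rpow_le hR hm hℓ) hM0
    have : 0 ≤ |m| ^ ℓ := by positivity
    linarith
  have hm4 : (1 + |m|) ^ ((1 : ℝ) / 4) ≤ (1 + |m|) ^ ((1 : ℝ) / 2) :=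
    Real.rpow_le_rpow_of_exponent_le (by linarith [abs_nonneg m]) (by norm_num)
  calc _ ≤ (1 + 3 * Real.pi) * ((1 + R ^ 2) ^ ((1 : ℝ) / 4) * (1 + |m|) ^ ((1 : ℝ) / 2)
        * t ^ (-(1 / 4) : ℝ)) * ((2 * M + 2 * R * M' + 1) * |m| ^ ℓ) := by
        refine mul_le_mul (by gcongr) hvar ?_ (by positivity)
        exact intervalIntegral.integral_nonneg hle fun x _ => abs_nonneg _
    _ = _ := by ring

/-- An oscillatory integral operator with bounded kernel maps `L¹` to `L^∞`. -/
theorem norm_integral_fourier_mul_le {p θ : ℝ → ℝ} (hp : Integrable p) (hθ : Continuous θ)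
    {f : ℝ → ℂ} (hf : Integrable f) {B : ℝ}
    (hB : ∀ z : ℝ, ‖∫ ξ, (p ξ : ℂ) * Complex.exp (Complex.I * ((z * ξ - θ ξ : ℝ) : ℂ))‖ ≤ B)
    (x : ℝ) :
    ‖∫ ξ : ℝ, (p ξ : ℂ) * Complex.exp (Complex.I * ((x * ξ - θ ξ : ℝ) : ℂ))
        * ∫ y : ℝ, Complex.exp (-(Complex.I * ((y * ξ : ℝ) : ℂ))) * f y‖ ≤ B * ∫ y, ‖f y‖ := by
  set k : ℝ → ℝ → ℂ := fun ξ y =>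
    Complex.exp (Complex.I * (((x - y) * ξ - θ ξ : ℝ) : ℂ)) * ((p ξ : ℂ) * f y) with hk
  have hki : Integrable (Function.uncurry k) (volume.prod volume) := by
    have h1 : Integrable (fun w : ℝ × ℝ => (p w.1 : ℂ) * f w.2) (volume.prod volume) :=
      hp.ofReal.mul_prod hf
    refine h1.bdd_mul (c := 1) (Continuous.aestronglyMeasurable (by fun_prop))
      (Filter.Eventually.of_forall fun w => ?_)
    rw [mul_comm, Complex.norm_exp_ofReal_mul_I]
  have h1 : ∀ ξ : ℝ, (p ξ : ℂ) * Complex.exp (Complex.I * ((x * ξ - θ ξ : ℝ) : ℂ))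
      * (∫ y : ℝ, Complex.exp (-(Complex.I * ((y * ξ : ℝ) : ℂ))) * f y) = ∫ y, k ξ y := by
    intro ξ
    rw [← integral_const_mul]
    refine integral_congr_ae (Filter.Eventually.of_forall fun y => ?_)
    have : Complex.exp (Complex.I * (((x - y) * ξ - θ ξ : ℝ) : ℂ))
        = Complex.exp (Complex.I * ((x * ξ - θ ξ : ℝ) : ℂ))
          * Complex.exp (-(Complex.I * ((y * ξ : ℝ) : ℂ))) := by
      rw [← Complex.exp_add]; congr 1; push_cast; ring
    simp only [hk, this]
    ring
  simp_rw [h1]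
  rw [integral_integral_swap hki, ← integral_const_mul]
  refine norm_integral_le_of_norm_le (hf.norm.const_mul B)
    (Filter.Eventually.of_forall fun y => ?_)
  have h2 : ∫ ξ, k ξ y
      = (∫ ξ, (p ξ : ℂ) * Complex.exp (Complex.I * (((x - y) * ξ - θ ξ : ℝ) : ℂ))) * f y := by
    rw [← integral_mul_const]
    refine integral_congr_ae (Filter.Eventually.of_forall fun ξ => ?_)
    simp only [hk]
    ring
  rw [h2, norm_mul]
  exact mul_le_mul_of_nonneg_right (hB _) (norm_nonneg _)

/-- Free massive estimate, low-energy part (Proposition 2.4):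
`‖(Δ²+m²)^{ℓ/2} e^{-it√(Δ²+m²)} χ₁(Δ²)‖_{L¹→L^∞} ≲ |m|^ℓ ⟨m⟩^{1/2} |t|^{-1/4}`
for `m ≠ 0` and `ℓ ≤ 0`, with `⟨m⟩ = 1 + |m|`. -/
theorem stmt_9 (lam₀ : ℝ) (hlam₀ : 0 < lam₀)
    (χ₁ : ℝ → ℝ) (hχ₁ : ContDiff ℝ (⊤ : ℕ∞) χ₁) (hχ₁c : HasCompactSupport χ₁)
    (hχ₁one : ∀ lam : ℝ, |lam| ≤ lam₀ → χ₁ lam = 1)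
    (hχ₁zero : ∀ lam : ℝ, 2 * lam₀ ≤ |lam| → χ₁ lam = 0)
    (ℓ : ℝ) (hℓ : ℓ ≤ 0) :
    ∃ C > 0, ∀ m : ℝ, m ≠ 0 → ∀ t : ℝ, t ≠ 0 → ∀ f : SchwartzMap ℝ ℂ, ∀ x : ℝ,
      ‖(2 * Real.pi)⁻¹ • ∫ ξ : ℝ,
          Complex.exp (Complex.I * ((x * ξ : ℝ) : ℂ))
          * (((ξ^4 + m^2) ^ (ℓ/2) : ℝ) : ℂ)
          * Complex.exp (-(Complex.I * ((t * Real.sqrt (ξ^4 + m^2) : ℝ) : ℂ)))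
          * ((χ₁ (ξ^4) : ℝ) : ℂ)
          * (∫ y : ℝ, Complex.exp (-(Complex.I * ((y * ξ : ℝ) : ℂ))) * f y)‖
      ≤ C * |m| ^ ℓ * (1 + |m|) ^ ((1:ℝ)/2) * |t| ^ (-(1/4) : ℝ)
          * ∫ y : ℝ, ‖f y‖ := by
  set R : ℝ := (2 * lam₀) ^ ((1 : ℝ) / 4) with hRdef
  have hR : 0 < R := by positivity
  have hR4 : R ^ 4 = 2 * lam₀ := by
    rw [hRdef, ← Real.rpow_mul_natCast (by positivity)]
    norm_num
  have hd : ∀ x : ℝ, HasDerivAt (fun x => χ₁ (x ^ 4)) (deriv χ₁ (x ^ 4) * (4 * x ^ 3)) x :=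
    fun x => by
      have h := ((hχ₁.differentiable (by simp)) (x ^ 4)).hasDerivAt.comp x (hasDerivAt_pow 4 x)
      exact h.congr_deriv (by norm_num)
  have hdc : Continuous fun x : ℝ => deriv χ₁ (x ^ 4) * (4 * x ^ 3) := by
    have := hχ₁.continuous_deriv (by simp)
    fun_prop
  have hzero : ∀ x : ℝ, R ≤ |x| → χ₁ (x ^ 4) = 0 := fun x hx => by
    refine hχ₁zero _ ?_
    rw [← hR4, abs_pow]
    exact pow_le_pow_left₀ hR.le hx 4
  obtain ⟨C, hC, hK⟩ := exists_norm_kernel_le hd hdc hR.le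
    (hzero R (le_abs_self R)) hℓ
  refine ⟨C, hC, fun m hm t ht f x => ?_⟩
  set p : ℝ → ℝ := fun ξ => (ξ ^ 4 + m ^ 2) ^ (ℓ / 2) * χ₁ (ξ ^ 4) with hp
  have hpc : Continuous p := (continuous_quartic_rpow hm _).mul
    (hχ₁.continuous.comp (continuous_pow 4))
  have hp0 : ∀ ξ, ξ ∉ Set.Ioc (-R) R → p ξ = 0 := fun ξ hξ => by
    have : R ≤ |ξ| := by
      by_contra! h
      exact hξ ⟨(abs_lt.1 h).1, (abs_lt.1 h).2.le⟩
    simp [hp, hzero ξ this]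
  have hpi : Integrable p := by
    refine hpc.integrable_of_hasCompactSupport (HasCompactSupport.intro
      (isCompact_Icc (a := -R) (b := R)) fun ξ hξ => hp0 ξ fun h => hξ (Set.Ioc_subset_Icc_self h))
  have hkernel : ∀ z : ℝ, ‖∫ ξ, (p ξ : ℂ)
      * Complex.exp (Complex.I * ((z * ξ - t * √(ξ ^ 4 + m ^ 2) : ℝ) : ℂ))‖
      ≤ C * |m| ^ ℓ * (1 + |m|) ^ ((1 : ℝ) / 2) * |t| ^ (-(1 / 4) : ℝ) := by
    intro z
    have hset : ∀ q : ℝ → ℂ, ∫ ξ, (p ξ : ℂ) * q ξ = ∫ ξ in (-R)..R, (p ξ : ℂ) * q ξ := by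
      intro q
      rw [intervalIntegral.integral_of_le (by linarith),
        setIntegral_eq_integral_of_forall_compl_eq_zero fun ξ hξ => by simp [hp0 ξ hξ]]
    rcases lt_or_gt_of_ne ht with h | h
    · have hk := hK m hm (-t) (by linarith) z
      rw [abs_of_neg h, hset]
      convert hk using 7
      ring_nf
    · have hk := hK m hm t h (-z)
      rw [← hset, ← Complex.norm_conj, ← integral_conj] at hk
      rw [abs_of_pos h]
      refine le_of_eq_of_le (congrArg norm (integral_congr_ae
        (Filter.Eventually.of_forall fun ξ => ?_))) hk
      beta_reduce
      rw [map_mul, Complex.conj_ofReal, ← Complex.exp_conj, map_mul, Complex.conj_I,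
        Complex.conj_ofReal]
      congr 2
      push_cast
      ring
  have hmain := norm_integral_fourier_mul_le hpi
    (by fun_prop : Continuous fun ξ : ℝ => t * √(ξ ^ 4 + m ^ 2)) f.integrable hkernel x
  rw [norm_smul]
  have h2pi : ‖(2 * Real.pi)⁻¹‖ ≤ 1 := by
    rw [Real.norm_of_nonneg (by positivity)]
    exact inv_le_one_of_one_le₀ (by linarith [Real.pi_gt_three])
  refine (mul_le_of_le_one_left (norm_nonneg _) h2pi).trans (le_of_eq_of_le ?_ hmain)
  congr 2
  ext ξ
  have : Complex.exp (Complex.I * ((x * ξ - t * √(ξ ^ 4 + m ^ 2) : ℝ) : ℂ))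
      = Complex.exp (Complex.I * ((x * ξ : ℝ) : ℂ))
        * Complex.exp (-(Complex.I * ((t * √(ξ ^ 4 + m ^ 2) : ℝ) : ℂ))) := by
    rw [← Complex.exp_add]; congr 1; push_cast; ring
  rw [this, hp]
  push_cast
  ring
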